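/- Let R be a commutative ring, let A be an n×n matrix over R, and let 1 ≤ s ≤ n. Then A * D_s(A) = (∑_{J} det(A.submatrix e_J e_J)) • 1 − D_{s−1}(A), where the sum runs over all (n−s+1)-element subsets J of Fin n, and D_{s−1}(A) denotes the matrix of z^(n−s+1)-coefficients of adjugate(1 + z·A) (which is 0 when s = 1). That is, the contraction of A with the reduced order-one complement of order s is an alternating sum of minor determinants of order n−s+1. -/

import Mathlib

/-- The reduced order-one complement of order `s` of an `n×n` matrix `A`:
the matrix whose `(i,j)` entry is the coefficient of `z^(n-s)` in the `(i,j)` entry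
of `adjugate (1 + z • A)`, computed over the polynomial ring `R[z]`. -/
noncomputable def redComp {R : Type*} [CommRing R] {n : ℕ} (s : ℕ)
    (A : Matrix (Fin n) (Fin n) R) : Matrix (Fin n) (Fin n) R :=
  Matrix.of fun i j =>
    (((1 + (Polynomial.X : Polynomial R) • A.map (fun a => Polynomial.C a) :
        Matrix (Fin n) (Fin n) (Polynomial R)).adjugate) i j).coeff (n - s)

open Polynomial in
/-- The coefficient of `z ^ (k + 1)` in the identity
`(1 + z • A) * adjugate (1 + z • A) = det (1 + z • A) • 1`. -/
theorem Matrix.coeff_succ_one_add_X_smul_mul_adjugate {R ι : Type*} [CommRing R] [Fintype ι]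
    [DecidableEq ι] (A : Matrix ι ι R) (k : ℕ) (i j : ι) :
    (((1 + (X : R[X]) • A.map C).adjugate) i j).coeff (k + 1)
        + ∑ l, A i l * (((1 + (X : R[X]) • A.map C).adjugate) l j).coeff k
      = (1 + (X : R[X]) • A.map C).det.coeff (k + 1) * (1 : Matrix ι ι R) i j := by
  have h := congrArg (fun M : Matrix ι ι R[X] => (M i j).coeff (k + 1))
    (Matrix.mul_adjugate (1 + (X : R[X]) • A.map C))
  simp only [add_mul, one_mul, Matrix.smul_mul, Matrix.add_apply, Matrix.smul_apply, smul_eq_mul,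
    coeff_add, coeff_X_mul] at h
  simp only [Matrix.mul_apply, Matrix.map_apply, finsetSum_coeff, coeff_C_mul] at h
  rw [h]
  by_cases hij : i = j
  · subst hij
    simp
  · simp [hij]

/-- The sum of the principal minors of order `k`, each computed along the increasing enumeration
of its index set, is the coefficient of `z ^ k` in `det (1 + z • A)`. -/
theorem Matrix.sum_det_submatrix_orderEmbOfFin {R ι : Type*} [CommRing R] [Fintype ι]
    [LinearOrder ι] (A : Matrix ι ι R) (k : ℕ) :
    ∑ J : {J : Finset ι // J.card = k},
        (A.submatrix (J.1.orderEmbOfFin J.2) (J.1.orderEmbOfFin J.2)).det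
      = (1 + (Polynomial.X : Polynomial R) • A.map Polynomial.C).det.coeff k := by
  rw [Matrix.coeff_det_one_add_X_smul_eq_sum_minors,
    Finset.sum_subtype (p := fun J : Finset ι => J.card = k) _ (by simp)]
  refine Finset.sum_congr rfl fun J _ => ?_
  rw [← Matrix.det_submatrix_equiv_self (J.1.orderIsoOfFin J.2).toEquiv]
  rfl

/-- For an `n×n` matrix `A` over a commutative ring and `1 ≤ s ≤ n`,
`A * D_s(A) = (∑_J det (A.submatrix e_J e_J)) • 1 − D_{s−1}(A)`, where the sum
runs over all `(n−s+1)`-element subsets `J` of `Fin n` and `D_{s−1}(A)` is the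
matrix of `z^(n−s+1)`-coefficients of `adjugate (1 + z • A)` (which is `0` when
`s = 1`).  That is, the contraction of `A` with the reduced order-one complement
of order `s` is an alternating sum of minor determinants of order `n−s+1`. -/
theorem mul_redComp_eq_sum_minors_sub {R : Type*} [CommRing R] {n : ℕ}
    (A : Matrix (Fin n) (Fin n) R) (s : ℕ) (hs1 : 1 ≤ s) (hsn : s ≤ n) :
    A * redComp s A
      = (∑ J : {J : Finset (Fin n) // J.card = n - s + 1},
            (A.submatrix (⇑(J.1.orderEmbOfFin J.2)) (⇑(J.1.orderEmbOfFin J.2))).det)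
          • (1 : Matrix (Fin n) (Fin n) R)
        - Matrix.of (fun i j =>
            (((1 + (Polynomial.X : Polynomial R) • A.map (fun a => Polynomial.C a) :
                Matrix (Fin n) (Fin n) (Polynomial R)).adjugate) i j).coeff
              (n - s + 1)) := by
  ext i j
  rw [Matrix.sum_det_submatrix_orderEmbOfFin, Matrix.sub_apply, eq_sub_iff_add_eq, add_comm]
  exact Matrix.coeff_succ_one_add_X_smul_mul_adjugate A (n - s) i j
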